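/- Let c > -1 and κ > 0, and define Q_c(y₀, r) = ∫_{y₀}^{y₀+r} y^c dy. Then there exist constants C ≥ 1 and κ' ≥ κ, depending only on c and κ, such that for all t, y, ρ > 0: (i) t^{−1/2} ρ^{−c} (1 ∧ ρ/√t)^c exp(−|y−ρ|²/(κ t)) ≤ C (Q_c(y,√t) Q_c(ρ,√t))^{−1/2} exp(−|y−ρ|²/(κ' t)), and (ii) (Q_c(y,√t) Q_c(ρ,√t))^{−1/2} exp(−|y−ρ|²/(κ t)) ≤ C t^{−1/2} ρ^{−c} (1 ∧ ρ/√t)^c exp(−|y−ρ|²/(κ' t)). -/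

import Mathlib

open MeasureTheory Set Real

/-- `Q_c(y₀, r) = ∫_{y₀}^{y₀+r} y^c dy`. -/
noncomputable def Qc (c y₀ r : ℝ) : ℝ := ∫ y in y₀..(y₀ + r), y ^ c

theorem Real.rpow_le_mul_rpow_of_comparable {a b k : ℝ} (e : ℝ) (ha : 0 < a) (hb : 0 < b)
    (hk : 0 < k) (hab : a ≤ k * b) (hba : b ≤ k * a) : a ^ e ≤ k ^ |e| * b ^ e := by
  rcases le_total 0 e with he | he
  · rw [abs_of_nonneg he, ← mul_rpow hk.le hb.le]
    exact rpow_le_rpow ha.le hab he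
  · rw [abs_of_nonpos he, rpow_neg hk.le, ← inv_rpow hk.le, ← mul_rpow (by positivity) hb.le]
    refine rpow_le_rpow_of_nonpos (by positivity) ?_ he
    rwa [inv_mul_le_iff₀ hk]

theorem Qc_eq {c y s : ℝ} (hc : -1 < c) (hy : 0 < y) (hs : 0 < s) :
    Qc c y s = (y + s) ^ (c + 1) * (1 - (y / (y + s)) ^ (c + 1)) / (c + 1) := by
  have hY : 0 < y + s := by positivity
  rw [Qc, integral_rpow (Or.inl hc), div_rpow hy.le hY.le, mul_sub, mul_one,
    mul_div_cancel₀ _ (rpow_pos_of_pos hY _).ne']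

/-- `Q_c(y, s)` is comparable to `s (y + s)^c`, uniformly in `y, s > 0`. -/
theorem exists_Qc_comparable {c : ℝ} (hc : -1 < c) :
    ∃ A : ℝ, 1 ≤ A ∧ ∀ y s : ℝ, 0 < y → 0 < s →
      Qc c y s ≤ A * (s * (y + s) ^ c) ∧ s * (y + s) ^ c ≤ A * Qc c y s := by
  have ha : 0 < c + 1 := by linarith
  refine ⟨max (c + 1) (1 / (c + 1)), ?_, fun y s hy hs => ?_⟩
  · rcases le_total 1 (c + 1) with h | h
    · exact le_max_of_le_left h
    · exact le_max_of_le_right (by rwa [le_div_iff₀ ha, one_mul])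
  have hY : 0 < y + s := by positivity
  have hP : 0 < s * (y + s) ^ c := by positivity
  set u := y / (y + s) with hu
  have hu0 : 0 < u := by positivity
  have hu1 : u ≤ 1 := by rw [hu, div_le_one hY]; linarith
  have key : (y + s) ^ (c + 1) * (1 - u) = s * (y + s) ^ c := by
    rw [rpow_add_one hY.ne', hu]; field_simp; ring
  have hYa : 0 < (y + s) ^ (c + 1) := by positivity
  have hQ : (c + 1) * Qc c y s = (y + s) ^ (c + 1) * (1 - u ^ (c + 1)) := by
    rw [Qc_eq hc hy hs]; field_simp; rfl
  rcases le_total 1 (c + 1) with h | h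
  · have h1 : 1 - u ≤ 1 - u ^ (c + 1) := by
      have := rpow_le_rpow_of_exponent_ge hu0 hu1 h
      rw [rpow_one] at this; linarith
    have h2 : 1 - u ^ (c + 1) ≤ (c + 1) * (1 - u) := by
      have := one_add_mul_self_le_rpow_one_add (s := u - 1) (by linarith) h
      rw [show 1 + (u - 1) = u by ring] at this; linarith
    have l := mul_le_mul_of_nonneg_left h1 hYa.le
    have r := mul_le_mul_of_nonneg_left h2 hYa.le
    rw [← hQ, key] at l
    rw [← hQ, mul_left_comm, key] at r
    have r' : Qc c y s ≤ s * (y + s) ^ c := le_of_mul_le_mul_left r ha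
    have hQ0 : 0 ≤ Qc c y s := (mul_nonneg_iff_of_pos_left ha).1 (hP.le.trans l)
    exact ⟨r'.trans (le_mul_of_one_le_left hP.le (le_max_of_le_left h)),
      l.trans (mul_le_mul_of_nonneg_right (le_max_left _ _) hQ0)⟩
  · have h1 : 1 - u ^ (c + 1) ≤ 1 - u := by
      have := rpow_le_rpow_of_exponent_ge hu0 hu1 h
      rw [rpow_one] at this; linarith
    have h2 : (c + 1) * (1 - u) ≤ 1 - u ^ (c + 1) := by
      have := rpow_one_add_le_one_add_mul_self (s := u - 1) (by linarith) ha.le h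
      rw [show 1 + (u - 1) = u by ring] at this; linarith
    have r := mul_le_mul_of_nonneg_left h1 hYa.le
    have l := mul_le_mul_of_nonneg_left h2 hYa.le
    rw [← hQ, key] at r
    rw [← hQ, mul_left_comm, key] at l
    have l' : s * (y + s) ^ c ≤ Qc c y s := le_of_mul_le_mul_left l ha
    have r' : Qc c y s ≤ 1 / (c + 1) * (s * (y + s) ^ c) := by
      rwa [one_div, le_inv_mul_iff₀ ha]
    have hA : (1 : ℝ) ≤ max (c + 1) (1 / (c + 1)) :=
      le_max_of_le_right (by rwa [le_div_iff₀ ha, one_mul])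
    exact ⟨r'.trans (mul_le_mul_of_nonneg_right (le_max_right _ _) hP.le),
      l'.trans (le_mul_of_one_le_left (hP.le.trans l') hA)⟩

theorem Qc_pos {c y s : ℝ} (hc : -1 < c) (hy : 0 < y) (hs : 0 < s) : 0 < Qc c y s := by
  obtain ⟨A, hA, h⟩ := exists_Qc_comparable hc
  have : 0 < A * Qc c y s := lt_of_lt_of_le (by positivity) (h y s hy hs).2
  exact (mul_pos_iff_of_pos_left (by linarith)).1 this

theorem rpow_neg_mul_min_one_div_rpow (c : ℝ) {ρ s : ℝ} (hρ : 0 < ρ) (hs : 0 < s) :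
    ρ ^ (-c) * (min 1 (ρ / s)) ^ c = (max ρ s) ^ (-c) := by
  rcases le_total ρ s with h | h
  · rw [min_eq_right ((div_le_one hs).2 h), max_eq_right h, div_rpow hρ.le hs.le,
      rpow_neg hρ.le, rpow_neg hs.le]
    have := (rpow_pos_of_pos hρ c).ne'
    field_simp
  · rw [min_eq_left ((one_le_div hs).2 h), max_eq_left h, one_rpow, mul_one]

/-- Passing from `y` to `ρ` in `y + s` costs at most a factor `exp (|y - ρ| / s)`. -/
theorem add_le_exp_abs_sub_div_mul_add {y ρ s : ℝ} (hρ : 0 < ρ) (hs : 0 < s) :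
    y + s ≤ exp (|y - ρ| / s) * (ρ + s) := by
  have h1 : |y - ρ| / s + 1 ≤ exp (|y - ρ| / s) := add_one_le_exp _
  have h2 : (|y - ρ| / s + 1) * (ρ + s) ≤ exp (|y - ρ| / s) * (ρ + s) :=
    mul_le_mul_of_nonneg_right h1 (by positivity)
  have h3 : (|y - ρ| / s + 1) * (ρ + s) = |y - ρ| / s * ρ + |y - ρ| + (ρ + s) := by
    field_simp
  have h4 : 0 ≤ |y - ρ| / s * ρ := by positivity
  linarith [le_abs_self (y - ρ)]

/-- `Q_c(y, s) Q_c(ρ, s)` is comparable to `s² max(ρ, s)^{2c}`, up to an exponential factor. -/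
theorem exists_Qc_mul_Qc_comparable {c : ℝ} (hc : -1 < c) :
    ∃ B : ℝ, 1 ≤ B ∧ ∀ y ρ s : ℝ, 0 < y → 0 < ρ → 0 < s →
      Qc c y s * Qc c ρ s
          ≤ B * exp (|c| * (|y - ρ| / s)) * (s * max ρ s ^ c) ^ 2 ∧
        (s * max ρ s ^ c) ^ 2
          ≤ B * exp (|c| * (|y - ρ| / s)) * (Qc c y s * Qc c ρ s) := by
  obtain ⟨A, hA, hQ⟩ := exists_Qc_comparable hc
  refine ⟨A ^ 2 * (2 ^ |c| * 2 ^ |c|), ?_, fun y ρ s hy hρ hs => ?_⟩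
  · have : (1 : ℝ) ≤ 2 ^ |c| := one_le_rpow one_le_two (abs_nonneg c)
    exact one_le_mul_of_one_le_of_one_le (one_le_pow₀ hA)
      (one_le_mul_of_one_le_of_one_le this this)
  obtain ⟨y1, y2⟩ := hQ y s hy hs
  obtain ⟨ρ1, ρ2⟩ := hQ ρ s hρ hs
  have hA0 : 0 < A := by linarith
  have hQy := Qc_pos hc hy hs
  have hQρ := Qc_pos hc hρ hs
  set E := exp (|y - ρ| / s) with hE
  have hE1 : 1 ≤ E := one_le_exp (by positivity)
  have hEc : exp (|c| * (|y - ρ| / s)) = E ^ |c| := by rw [hE, ← exp_mul, mul_comm]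
  have hM : 0 < max ρ s := lt_max_of_lt_left hρ
  set M := max ρ s with hMdef
  have hM1 : M ≤ ρ + s := max_le (by linarith) (by linarith)
  have hM2 : ρ + s ≤ 2 * M := by linarith [le_max_left ρ s, le_max_right ρ s]
  have hyρ : y + s ≤ E * (ρ + s) := add_le_exp_abs_sub_div_mul_add hρ hs
  have hρy : ρ + s ≤ E * (y + s) := by
    rw [hE, abs_sub_comm]; exact add_le_exp_abs_sub_div_mul_add hy hs
  have hY : 0 < y + s := by positivity
  have hR : 0 < ρ + s := by positivity
  have a1 : M ≤ 2 * (ρ + s) := by linarith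
  have b1 : y + s ≤ 2 * E * M := by nlinarith
  have b2 : M ≤ 2 * E * (y + s) := by nlinarith [mul_pos (show 0 < E by linarith) hY]
  have hE2 : (2 * E) ^ |c| = 2 ^ |c| * E ^ |c| := mul_rpow zero_le_two (by linarith)
  have c1 := rpow_le_mul_rpow_of_comparable c hR hM two_pos hM2 a1
  have c2 := rpow_le_mul_rpow_of_comparable c hM hR two_pos a1 hM2
  have d1 := rpow_le_mul_rpow_of_comparable c hY hM (by positivity) b1 b2
  have d2 := rpow_le_mul_rpow_of_comparable c hM hY (by positivity) b2 b1
  rw [hE2] at d1 d2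
  rw [hEc]
  constructor
  · calc Qc c y s * Qc c ρ s ≤ A * (s * (y + s) ^ c) * (A * (s * (ρ + s) ^ c)) := by gcongr
      _ ≤ A * (s * (2 ^ |c| * E ^ |c| * M ^ c)) * (A * (s * (2 ^ |c| * M ^ c))) := by gcongr
      _ = _ := by ring
  · calc (s * M ^ c) ^ 2 = s * M ^ c * (s * M ^ c) := sq _
      _ ≤ s * (2 ^ |c| * E ^ |c| * (y + s) ^ c) * (s * (2 ^ |c| * (ρ + s) ^ c)) := by gcongr
      _ = 2 ^ |c| * E ^ |c| * (s * (y + s) ^ c) * (2 ^ |c| * (s * (ρ + s) ^ c)) := by ring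
      _ ≤ 2 ^ |c| * E ^ |c| * (A * Qc c y s) * (2 ^ |c| * (A * Qc c ρ s)) := by gcongr
      _ = _ := by ring

/-- Linear exponential growth is absorbed by doubling the width of a Gaussian. -/
theorem exp_mul_mul_exp_neg_sq_div_le {κ : ℝ} (hκ : 0 < κ) (p d : ℝ) :
    exp (p * d) * exp (-d ^ 2 / κ) ≤ exp (p ^ 2 * κ / 2) * exp (-d ^ 2 / (2 * κ)) := by
  rw [← exp_add, ← exp_add, exp_le_exp]
  have h : p ^ 2 * κ / 2 + -d ^ 2 / (2 * κ) - (p * d + -d ^ 2 / κ)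
      = (p * κ - d) ^ 2 / (2 * κ) := by
    field_simp
    ring
  have : 0 ≤ (p * κ - d) ^ 2 / (2 * κ) := by positivity
  linarith

/-- for `c > -1` and `κ > 0` there exist `C ≥ 1` and `κ' ≥ κ` (depending
only on `c` and `κ`) such that for all `t, y, ρ > 0`:
(i) `t^{-1/2} ρ^{-c} (1 ∧ ρ/√t)^c e^{-|y-ρ|²/(κt)}
      ≤ C (Q_c(y,√t) Q_c(ρ,√t))^{-1/2} e^{-|y-ρ|²/(κ't)}`, and
(ii) `(Q_c(y,√t) Q_c(ρ,√t))^{-1/2} e^{-|y-ρ|²/(κt)}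
      ≤ C t^{-1/2} ρ^{-c} (1 ∧ ρ/√t)^c e^{-|y-ρ|²/(κ't)}`. -/
theorem statement_4 (c κ : ℝ) (hc : -1 < c) (hκ : 0 < κ) :
    ∃ C κ' : ℝ, 1 ≤ C ∧ κ ≤ κ' ∧
      ∀ t y ρ : ℝ, 0 < t → 0 < y → 0 < ρ →
        (t ^ (-(1:ℝ)/2) * ρ ^ (-c) * (min 1 (ρ / Real.sqrt t)) ^ c
            * Real.exp (-(y - ρ) ^ 2 / (κ * t))
          ≤ C * (Qc c y (Real.sqrt t) * Qc c ρ (Real.sqrt t)) ^ (-(1:ℝ)/2)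
            * Real.exp (-(y - ρ) ^ 2 / (κ' * t)))
        ∧ ((Qc c y (Real.sqrt t) * Qc c ρ (Real.sqrt t)) ^ (-(1:ℝ)/2)
            * Real.exp (-(y - ρ) ^ 2 / (κ * t))
          ≤ C * (t ^ (-(1:ℝ)/2) * ρ ^ (-c) * (min 1 (ρ / Real.sqrt t)) ^ c)
            * Real.exp (-(y - ρ) ^ 2 / (κ' * t))) := by
  obtain ⟨B, hB, hQ⟩ := exists_Qc_mul_Qc_comparable hc
  refine ⟨B ^ (1 / 2 : ℝ) * exp ((|c| / 2) ^ 2 * κ / 2), 2 * κ, ?_, by linarith,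
    fun t y ρ ht hy hρ => ?_⟩
  · exact one_le_mul_of_one_le_of_one_le (one_le_rpow hB (by norm_num))
      (one_le_exp (by positivity))
  obtain ⟨s, hs, rfl⟩ : ∃ s : ℝ, 0 < s ∧ t = s ^ 2 := ⟨√t, sqrt_pos.2 ht, (sq_sqrt ht.le).symm⟩
  rw [sqrt_sq hs.le]
  obtain ⟨h1, h2⟩ := hQ y ρ s hy hρ hs
  have hQQ : 0 < Qc c y s * Qc c ρ s := mul_pos (Qc_pos hc hy hs) (Qc_pos hc hρ hs)
  have hM : 0 < max ρ s := lt_max_of_lt_left hρ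
  have hW : 0 < (s * max ρ s ^ c) ^ 2 := by positivity
  set d := |y - ρ| / s with hd
  have hF : (s ^ 2) ^ (-(1 : ℝ) / 2) * ρ ^ (-c) * (min 1 (ρ / s)) ^ c
      = ((s * max ρ s ^ c) ^ 2) ^ (-(1 : ℝ) / 2) := by
    rw [mul_assoc, rpow_neg_mul_min_one_div_rpow c hρ hs, mul_pow,
      mul_rpow (by positivity) (by positivity)]
    congr 1
    rw [← rpow_natCast, ← rpow_mul (by positivity), ← rpow_mul hM.le]
    congr 1
    push_cast
    ring
  have hk : 0 < B * exp (|c| * d) := by positivity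
  have hkpow : (B * exp (|c| * d)) ^ |(-(1 : ℝ) / 2)| = B ^ (1 / 2 : ℝ) * exp (|c| / 2 * d) := by
    rw [show |(-(1 : ℝ) / 2)| = 1 / 2 by rw [abs_of_neg] <;> norm_num,
      mul_rpow (by linarith) (exp_pos _).le, ← exp_mul]
    congr 2
    ring
  have e1 := rpow_le_mul_rpow_of_comparable (-(1 : ℝ) / 2) hW hQQ hk h2 h1
  have e2 := rpow_le_mul_rpow_of_comparable (-(1 : ℝ) / 2) hQQ hW hk h1 h2
  rw [hkpow] at e1 e2
  have hexp (K : ℝ) : -(y - ρ) ^ 2 / (K * s ^ 2) = -d ^ 2 / K := by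
    rw [hd, div_pow, sq_abs, neg_div, neg_div, div_div, mul_comm K]
  rw [hF, hexp, hexp]
  have hg := exp_mul_mul_exp_neg_sq_div_le hκ (|c| / 2) d
  have absorb {F G : ℝ} (hG : 0 ≤ G) (h : F ≤ B ^ (1 / 2 : ℝ) * exp (|c| / 2 * d) * G) :
      F * exp (-d ^ 2 / κ)
        ≤ B ^ (1 / 2 : ℝ) * exp ((|c| / 2) ^ 2 * κ / 2) * G * exp (-d ^ 2 / (2 * κ)) :=
    calc F * exp (-d ^ 2 / κ)
        ≤ B ^ (1 / 2 : ℝ) * exp (|c| / 2 * d) * G * exp (-d ^ 2 / κ) := by gcongr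
      _ = B ^ (1 / 2 : ℝ) * G * (exp (|c| / 2 * d) * exp (-d ^ 2 / κ)) := by ring
      _ ≤ B ^ (1 / 2 : ℝ) * G * (exp ((|c| / 2) ^ 2 * κ / 2) * exp (-d ^ 2 / (2 * κ))) := by
        gcongr
      _ = _ := by ring
  exact ⟨absorb (by positivity) e1, absorb (by positivity) e2⟩
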